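/- arXiv:2601.07174 — 2 statements merged into one kernel-verified Lean document; each statement's English description precedes it below -/
import Mathlib

section
/- Discrete integration operator and its stability: let v be a discrete function defined at the points (x_i, y_{j+1/2}), 1 ≤ i ≤ n_x−1, 0 ≤ j ≤ n_y−1, and define τ at the cell centers by τ_{i+1/2,j+1/2} = Σ_{k=1}^{i} h_k v_{k,j+1/2} (with empty sum for i = 0). Then (i) [D_x τ]_{i,j+1/2} = v_{i,j+1/2} for all 1 ≤ i ≤ n_x−1, 0 ≤ j ≤ n_y−1, and (ii) ‖τ‖_M ≤ ‖v‖_{TM}. -/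
open Finset

noncomputable section

/-- The midpoint `x_{i+1/2} = (x_i + x_{i+1})/2`. -/
def midpt (x : ℕ → ℝ) (i : ℕ) : ℝ := (x i + x (i + 1)) / 2

/-- The cell width `h_{i+1/2} = x_{i+1} - x_i`. -/
def hMid (x : ℕ → ℝ) (i : ℕ) : ℝ := x (i + 1) - x i

/-- `h_i = x_{i+1/2} - x_{i-1/2}` for `1 ≤ i ≤ n-1`, together with the boundary
conventions `h_0 = h_{1/2}/2` and `h_n = h_{n-1/2}/2`. -/
def hNode (x : ℕ → ℝ) (n i : ℕ) : ℝ :=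
  if i = 0 then hMid x 0 / 2
  else if i = n then hMid x (n - 1) / 2
  else midpt x i - midpt x (i - 1)

/-- `0 = x_0 < x_1 < ⋯ < x_n = 1`. -/
def IsGrid (x : ℕ → ℝ) (n : ℕ) : Prop :=
  x 0 = 0 ∧ x n = 1 ∧ ∀ i < n, x i < x (i + 1)

/-- Discrete inner product `(φ,θ)_M` over the cell centers `(x_{i+1/2}, y_{j+1/2})`. -/
def ipM (x y : ℕ → ℝ) (nx ny : ℕ) (φ θ : ℕ → ℕ → ℝ) : ℝ :=
  ∑ i ∈ range nx, ∑ j ∈ range ny, hMid x i * hMid y j * φ i j * θ i j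

/-- Discrete inner product `(φ,θ)_T` over the grid nodes `(x_i, y_j)`. -/
def ipT (x y : ℕ → ℝ) (nx ny : ℕ) (φ θ : ℕ → ℕ → ℝ) : ℝ :=
  ∑ i ∈ range (nx + 1), ∑ j ∈ range (ny + 1), hNode x nx i * hNode y ny j * φ i j * θ i j

/-- Discrete inner product `(φ,θ)_{TM}` over the points `(x_i, y_{j+1/2})`,
`1 ≤ i ≤ n_x - 1`, `0 ≤ j ≤ n_y - 1`. -/
def ipTM (x y : ℕ → ℝ) (nx ny : ℕ) (φ θ : ℕ → ℕ → ℝ) : ℝ :=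
  ∑ i ∈ Ico 1 nx, ∑ j ∈ range ny, hNode x nx i * hMid y j * φ i j * θ i j

/-- Discrete inner product `(φ,θ)_{MT}` over the points `(x_{i+1/2}, y_j)`,
`0 ≤ i ≤ n_x - 1`, `1 ≤ j ≤ n_y - 1`. -/
def ipMT (x y : ℕ → ℝ) (nx ny : ℕ) (φ θ : ℕ → ℕ → ℝ) : ℝ :=
  ∑ i ∈ range nx, ∑ j ∈ Ico 1 ny, hMid x i * hNode y ny j * φ i j * θ i j

theorem IsGrid.le_of_le {x : ℕ → ℝ} {n : ℕ} (hx : IsGrid x n) {a b : ℕ}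
    (hab : a ≤ b) (hb : b ≤ n) : x a ≤ x b := by
  induction b, hab using Nat.le_induction with
  | base => exact le_rfl
  | succ m _ ih => exact (ih (by omega)).trans (hx.2.2 m (by omega)).le

theorem IsGrid.nonneg {x : ℕ → ℝ} {n : ℕ} (hx : IsGrid x n) {i : ℕ} (hi : i ≤ n) : 0 ≤ x i :=
  hx.1 ▸ hx.le_of_le (Nat.zero_le i) hi

theorem IsGrid.le_one {x : ℕ → ℝ} {n : ℕ} (hx : IsGrid x n) {i : ℕ} (hi : i ≤ n) : x i ≤ 1 :=
  hx.2.1 ▸ hx.le_of_le hi le_rfl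

theorem IsGrid.hMid_pos {x : ℕ → ℝ} {n : ℕ} (hx : IsGrid x n) {i : ℕ} (hi : i < n) :
    0 < hMid x i :=
  sub_pos.2 (hx.2.2 i hi)

theorem IsGrid.sum_hMid {x : ℕ → ℝ} {n : ℕ} (hx : IsGrid x n) :
    ∑ i ∈ range n, hMid x i = 1 := by
  simp only [hMid, sum_range_sub, hx.1, hx.2.1, sub_zero]

theorem hNode_succ (x : ℕ → ℝ) {n i : ℕ} (hi : i + 1 < n) :
    hNode x n (i + 1) = midpt x (i + 1) - midpt x i := by
  simp [hNode, hi.ne]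

theorem IsGrid.hNode_pos {x : ℕ → ℝ} {n : ℕ} (hx : IsGrid x n) {i : ℕ} (h1 : 1 ≤ i)
    (hi : i < n) : 0 < hNode x n i := by
  obtain ⟨i, rfl⟩ := Nat.exists_eq_add_of_le' h1
  rw [hNode_succ x hi, midpt, midpt]
  linarith [hx.2.2 i (by omega), hx.2.2 (i + 1) hi]

theorem sum_hNode_Icc (x : ℕ → ℝ) {n i : ℕ} (hi : i < n) :
    ∑ k ∈ Icc 1 i, hNode x n k = midpt x i - midpt x 0 := by
  induction i with
  | zero => simp
  | succ i ih =>
    rw [sum_Icc_succ_top (by omega), ih (by omega), hNode_succ x hi]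
    ring

theorem IsGrid.sum_hNode_le_one {x : ℕ → ℝ} {n : ℕ} (hx : IsGrid x n) {i : ℕ} (hi : i < n) :
    ∑ k ∈ Icc 1 i, hNode x n k ≤ 1 := by
  rw [sum_hNode_Icc x hi, midpt, midpt]
  linarith [hx.le_one hi.le, hx.le_one (Nat.succ_le_of_lt hi), hx.1, hx.nonneg (i := 1) (by omega)]

/-- The Cauchy–Schwarz bound for the partial sums of `h_k w_k` on a grid of the unit interval. -/
theorem IsGrid.sq_sum_hNode_mul_le {x : ℕ → ℝ} {n : ℕ} (hx : IsGrid x n) (w : ℕ → ℝ)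
    {i : ℕ} (hi : i < n) :
    (∑ k ∈ Icc 1 i, hNode x n k * w k) ^ 2 ≤ ∑ k ∈ Ico 1 n, hNode x n k * w k ^ 2 := by
  have hpos : ∀ k ∈ Icc 1 i, 0 ≤ hNode x n k := fun k hk => by
    rw [mem_Icc] at hk
    exact (hx.hNode_pos hk.1 (by omega)).le
  have hterm : ∀ k ∈ Icc 1 i, 0 ≤ hNode x n k * w k ^ 2 := fun k hk =>
    mul_nonneg (hpos k hk) (sq_nonneg _)
  calc (∑ k ∈ Icc 1 i, hNode x n k * w k) ^ 2
      ≤ (∑ k ∈ Icc 1 i, hNode x n k) * ∑ k ∈ Icc 1 i, hNode x n k * w k ^ 2 :=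
        sum_sq_le_sum_mul_sum_of_sq_le_mul _ hpos hterm fun k _ => le_of_eq (by ring)
    _ ≤ ∑ k ∈ Icc 1 i, hNode x n k * w k ^ 2 :=
        mul_le_of_le_one_left (sum_nonneg hterm) (hx.sum_hNode_le_one hi)
    _ ≤ ∑ k ∈ Ico 1 n, hNode x n k * w k ^ 2 := by
        refine sum_le_sum_of_subset_of_nonneg (fun k hk => ?_) fun k hk _ => ?_
        · rw [mem_Icc] at hk
          exact mem_Ico.2 ⟨hk.1, by omega⟩
        · rw [mem_Ico] at hk
          exact mul_nonneg (hx.hNode_pos hk.1 hk.2).le (sq_nonneg _)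

/-- The discrete integration operator and its stability: if
`τ_{i+1/2,j+1/2} = ∑_{k=1}^{i} h_k v_{k,j+1/2}`, then `[D_x τ]_{i,j+1/2} = v_{i,j+1/2}`
for all interior `i`, and `‖τ‖_M ≤ ‖v‖_{TM}`. -/
theorem mac_discrete_integration_operator
    (nx ny : ℕ) (hnx : 2 ≤ nx) (hny : 2 ≤ ny)
    (x y : ℕ → ℝ) (hx : IsGrid x nx) (hy : IsGrid y ny)
    (v τ : ℕ → ℕ → ℝ)
    (hτ : ∀ i j, τ i j = ∑ k ∈ Icc 1 i, hNode x nx k * v k j) :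
    (∀ i, 1 ≤ i → i < nx → ∀ j < ny,
        (τ i j - τ (i - 1) j) / hNode x nx i = v i j) ∧
    Real.sqrt (ipM x y nx ny τ τ) ≤ Real.sqrt (ipTM x y nx ny v v) := by
  refine ⟨fun i h1 hi j _ => ?_, Real.sqrt_le_sqrt ?_⟩
  · have hpos := hx.hNode_pos h1 hi
    obtain ⟨i, rfl⟩ := Nat.exists_eq_add_of_le' h1
    rw [hτ, hτ, Nat.add_sub_cancel, sum_Icc_succ_top (by omega), add_sub_cancel_left,
      mul_div_cancel_left₀ _ hpos.ne']
  · have hle : ∀ i ∈ range nx, ∀ j ∈ range ny,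
        hMid x i * hMid y j * τ i j * τ i j ≤
          hMid x i * (hMid y j * ∑ k ∈ Ico 1 nx, hNode x nx k * v k j ^ 2) := by
      intro i hi j hj
      rw [mem_range] at hi hj
      have hsq := hx.sq_sum_hNode_mul_le (fun k => v k j) hi
      rw [← hτ] at hsq
      calc hMid x i * hMid y j * τ i j * τ i j = hMid x i * (hMid y j * τ i j ^ 2) := by ring
        _ ≤ _ := mul_le_mul_of_nonneg_left
          (mul_le_mul_of_nonneg_left hsq (hy.hMid_pos hj).le) (hx.hMid_pos hi).le
    calc ipM x y nx ny τ τ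
        ≤ ∑ i ∈ range nx, ∑ j ∈ range ny,
            hMid x i * (hMid y j * ∑ k ∈ Ico 1 nx, hNode x nx k * v k j ^ 2) :=
          sum_le_sum fun i hi => sum_le_sum (hle i hi)
      _ = ∑ j ∈ range ny, hMid y j * ∑ k ∈ Ico 1 nx, hNode x nx k * v k j ^ 2 := by
          rw [← sum_mul_sum, hx.sum_hMid, one_mul]
      _ = ipTM x y nx ny v v := by
          rw [ipTM, sum_comm]
          refine sum_congr rfl fun j _ => ?_
          rw [mul_sum]
          exact sum_congr rfl fun k _ => by ring
end
end

section
/- Boundedness of the discrete elasticity bilinear form: for all λ, μ > 0 and all discrete tensors Z = (Z^{11}, Z^{22}, Z^{12}) and τ = (τ^{11}, τ^{22}, τ^{12}), one has |a_h(λ; Z, τ)| ≤ (1/μ)‖Z‖·‖τ‖, where ‖Z‖ = (‖Z^{11}‖_M² + ‖Z^{22}‖_M² + ‖Z^{12}‖_T²)^{1/2}. -/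
open Finset

noncomputable section

/-- The discrete elasticity bilinear form `a_h(λ; Z, τ)`. -/
def aForm (x y : ℕ → ℝ) (nx ny : ℕ) (lam mu : ℝ)
    (Z11 Z22 Z12 t11 t22 t12 : ℕ → ℕ → ℝ) : ℝ :=
  (1 / mu) * ipT x y nx ny Z12 t12
    - (1 / (2 * mu)) * (lam / (2 * lam + 2 * mu)) *
        (ipM x y nx ny Z11 t22 + ipM x y nx ny Z22 t11)
    + (1 / (2 * mu)) * (1 - lam / (2 * lam + 2 * mu)) *
        (ipM x y nx ny Z11 t11 + ipM x y nx ny Z22 t22)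

theorem hMid_nonneg {x : ℕ → ℝ} {n i : ℕ} (hx : IsGrid x n) (hi : i < n) : 0 ≤ hMid x i :=
  sub_nonneg.2 (hx.2.2 i hi).le

theorem hNode_nonneg {x : ℕ → ℝ} {n i : ℕ} (hx : IsGrid x n) (hn : 0 < n) (hi : i ≤ n) :
    0 ≤ hNode x n i := by
  unfold hNode
  split_ifs with h0 h1
  · exact div_nonneg (hMid_nonneg hx hn) zero_le_two
  · exact div_nonneg (hMid_nonneg hx (by omega)) zero_le_two
  · obtain ⟨k, rfl⟩ := Nat.exists_eq_succ_of_ne_zero h0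
    have h2 := hx.2.2 k (by omega)
    have h3 := hx.2.2 (k + 1) (by omega)
    simp only [midpt, Nat.succ_eq_add_one, Nat.add_sub_cancel]
    linarith

/-- Cauchy–Schwarz inequality for finite sums with nonnegative weights. -/
theorem abs_sum_weight_mul_le {ι : Type*} (s : Finset ι) (w f g : ι → ℝ)
    (hw : ∀ i ∈ s, 0 ≤ w i) :
    |∑ i ∈ s, w i * f i * g i|
      ≤ √(∑ i ∈ s, w i * f i * f i) * √(∑ i ∈ s, w i * g i * g i) := by
  rw [← Real.sqrt_mul (sum_nonneg fun i hi => by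
    rw [mul_assoc]; exact mul_nonneg (hw i hi) (mul_self_nonneg _))]
  refine Real.abs_le_sqrt (sum_sq_le_sum_mul_sum_of_sq_le_mul s ?_ ?_ ?_)
  · intro i hi
    rw [mul_assoc]; exact mul_nonneg (hw i hi) (mul_self_nonneg _)
  · intro i hi
    rw [mul_assoc]; exact mul_nonneg (hw i hi) (mul_self_nonneg _)
  · intro i _
    exact le_of_eq (by ring)

theorem ipM_self_nonneg {x y : ℕ → ℝ} {nx ny : ℕ} (hx : IsGrid x nx) (hy : IsGrid y ny)
    (φ : ℕ → ℕ → ℝ) : 0 ≤ ipM x y nx ny φ φ := by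
  refine sum_nonneg fun i hi => sum_nonneg fun j hj => ?_
  rw [mul_assoc]
  exact mul_nonneg (mul_nonneg (hMid_nonneg hx (mem_range.1 hi))
    (hMid_nonneg hy (mem_range.1 hj))) (mul_self_nonneg _)

theorem ipT_self_nonneg {x y : ℕ → ℝ} {nx ny : ℕ} (hx : IsGrid x nx) (hy : IsGrid y ny)
    (hnx : 0 < nx) (hny : 0 < ny) (φ : ℕ → ℕ → ℝ) : 0 ≤ ipT x y nx ny φ φ := by
  refine sum_nonneg fun i hi => sum_nonneg fun j hj => ?_
  rw [mul_assoc]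
  exact mul_nonneg (mul_nonneg (hNode_nonneg hx hnx (mem_range_succ_iff.1 hi))
    (hNode_nonneg hy hny (mem_range_succ_iff.1 hj))) (mul_self_nonneg _)

theorem abs_ipM_le {x y : ℕ → ℝ} {nx ny : ℕ} (hx : IsGrid x nx) (hy : IsGrid y ny)
    (φ θ : ℕ → ℕ → ℝ) :
    |ipM x y nx ny φ θ| ≤ √(ipM x y nx ny φ φ) * √(ipM x y nx ny θ θ) := by
  simp only [ipM, ← sum_product']
  refine abs_sum_weight_mul_le _ (fun p : ℕ × ℕ => hMid x p.1 * hMid y p.2)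
    (fun p => φ p.1 p.2) (fun p => θ p.1 p.2) fun p hp => ?_
  rw [mem_product, mem_range, mem_range] at hp
  exact mul_nonneg (hMid_nonneg hx hp.1) (hMid_nonneg hy hp.2)

theorem abs_ipT_le {x y : ℕ → ℝ} {nx ny : ℕ} (hx : IsGrid x nx) (hy : IsGrid y ny)
    (hnx : 0 < nx) (hny : 0 < ny) (φ θ : ℕ → ℕ → ℝ) :
    |ipT x y nx ny φ θ| ≤ √(ipT x y nx ny φ φ) * √(ipT x y nx ny θ θ) := by
  simp only [ipT, ← sum_product']
  refine abs_sum_weight_mul_le _ (fun p : ℕ × ℕ => hNode x nx p.1 * hNode y ny p.2)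
    (fun p => φ p.1 p.2) (fun p => θ p.1 p.2) fun p hp => ?_
  rw [mem_product, mem_range_succ_iff, mem_range_succ_iff] at hp
  exact mul_nonneg (hNode_nonneg hx hnx hp.1) (hNode_nonneg hy hny hp.2)

/-- Cauchy–Schwarz inequality in the plane, with square roots as coordinates. -/
theorem sqrt_mul_sqrt_add_le {a b c d : ℝ} (ha : 0 ≤ a) (hb : 0 ≤ b) (hc : 0 ≤ c) (hd : 0 ≤ d) :
    √a * √c + √b * √d ≤ √(a + b) * √(c + d) := by
  rw [← Real.sqrt_mul (add_nonneg ha hb)]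
  refine Real.le_sqrt_of_sq_le ?_
  have h := sq_nonneg (√a * √d - √b * √c)
  have ea := Real.sq_sqrt ha
  have eb := Real.sq_sqrt hb
  have ec := Real.sq_sqrt hc
  have ed := Real.sq_sqrt hd
  calc (√a * √c + √b * √d) ^ 2 ≤ (√a ^ 2 + √b ^ 2) * (√c ^ 2 + √d ^ 2) := by linarith
    _ = (a + b) * (c + d) := by rw [ea, eb, ec, ed]

/-- Boundedness of the discrete elasticity bilinear form:
`|a_h(λ; Z, τ)| ≤ (1/μ)‖Z‖ ‖τ‖`, where
`‖Z‖ = (‖Z¹¹‖_M² + ‖Z²²‖_M² + ‖Z¹²‖_T²)^{1/2}`. -/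
theorem mac_aForm_bounded
    (nx ny : ℕ) (hnx : 2 ≤ nx) (hny : 2 ≤ ny)
    (x y : ℕ → ℝ) (hx : IsGrid x nx) (hy : IsGrid y ny)
    (lam mu : ℝ) (hlam : 0 < lam) (hmu : 0 < mu)
    (Z11 Z22 Z12 t11 t22 t12 : ℕ → ℕ → ℝ) :
    |aForm x y nx ny lam mu Z11 Z22 Z12 t11 t22 t12|
      ≤ (1 / mu)
        * Real.sqrt (ipM x y nx ny Z11 Z11 + ipM x y nx ny Z22 Z22
            + ipT x y nx ny Z12 Z12)
        * Real.sqrt (ipM x y nx ny t11 t11 + ipM x y nx ny t22 t22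
            + ipT x y nx ny t12 t12) := by
  have hnx0 : 0 < nx := by omega
  have hny0 : 0 < ny := by omega
  have z1 := ipM_self_nonneg hx hy Z11
  have z2 := ipM_self_nonneg hx hy Z22
  have z3 := ipT_self_nonneg hx hy hnx0 hny0 Z12
  have s1 := ipM_self_nonneg hx hy t11
  have s2 := ipM_self_nonneg hx hy t22
  have s3 := ipT_self_nonneg hx hy hnx0 hny0 t12
  have h11 := abs_le.1 (abs_ipM_le hx hy Z11 t11)
  have h22 := abs_le.1 (abs_ipM_le hx hy Z22 t22)
  have h12 := abs_le.1 (abs_ipM_le hx hy Z11 t22)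
  have h21 := abs_le.1 (abs_ipM_le hx hy Z22 t11)
  have hT := abs_le.1 (abs_ipT_le hx hy hnx0 hny0 Z12 t12)
  have hdiag := sqrt_mul_sqrt_add_le z1 z2 s1 s2
  have hcross := sqrt_mul_sqrt_add_le z1 z2 s2 s1
  rw [add_comm (ipM x y nx ny t22 t22)] at hcross
  have htotal := sqrt_mul_sqrt_add_le (add_nonneg z1 z2) z3 (add_nonneg s1 s2) s3
  have hRS := mul_nonneg (Real.sqrt_nonneg (ipM x y nx ny Z11 Z11 + ipM x y nx ny Z22 Z22))
    (Real.sqrt_nonneg (ipM x y nx ny t11 t11 + ipM x y nx ny t22 t22))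
  set R := √(ipM x y nx ny Z11 Z11 + ipM x y nx ny Z22 Z22)
    * √(ipM x y nx ny t11 t11 + ipM x y nx ny t22 t22)
  set c := lam / (2 * lam + 2 * mu) with hc
  have hc0 : 0 ≤ c := by positivity
  have hc1 : 0 ≤ 1 - c := by
    rw [hc, sub_nonneg, div_le_one (by positivity)]
    linarith
  have hD : |ipM x y nx ny Z11 t11 + ipM x y nx ny Z22 t22| ≤ R :=
    abs_le.2 ⟨by linarith, by linarith⟩
  have hC : |ipM x y nx ny Z11 t22 + ipM x y nx ny Z22 t11| ≤ R :=
    abs_le.2 ⟨by linarith, by linarith⟩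
  have hD' := abs_le.1 hD
  have hC' := abs_le.1 hC
  have d1 := mul_le_mul_of_nonneg_left hD'.1 hc1
  have d2 := mul_le_mul_of_nonneg_left hD'.2 hc1
  have c1 := mul_le_mul_of_nonneg_left hC'.1 hc0
  have c2 := mul_le_mul_of_nonneg_left hC'.2 hc0
  have hform : aForm x y nx ny lam mu Z11 Z22 Z12 t11 t22 t12
      = (1 / mu) * (ipT x y nx ny Z12 t12
        + ((1 - c) * (ipM x y nx ny Z11 t11 + ipM x y nx ny Z22 t22)
          - c * (ipM x y nx ny Z11 t22 + ipM x y nx ny Z22 t11)) / 2) := by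
    rw [aForm, ← hc]
    field_simp
    ring
  rw [hform, abs_mul, abs_of_pos (one_div_pos.2 hmu), mul_assoc]
  refine mul_le_mul_of_nonneg_left (abs_le.2 ⟨?_, ?_⟩) (one_div_pos.2 hmu).le <;> linarith
end
end
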